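/- Fix an algebraic closure ℚ̄ of ℚ. Let F be a number field (a finite extension of ℚ), let S be a finite set of prime numbers, and let τ, σ : F →+* ℚ̄ be two field embeddings. Then there exist a prime number p ∉ S, a field embedding j : ℚ̄ →+* ℚ̄_p into a fixed algebraic closure ℚ̄_p of the field ℚ_p of p-adic numbers, and a ℚ_p-algebra automorphism g of ℚ̄_p (an element of Gal(ℚ̄_p/ℚ_p)), such that j ∘ σ = g ∘ j ∘ τ as maps F → ℚ̄_p. -/

import Mathlib

section

open NumberField IsDedekindDomain Filter Topology Asymptotics
open scoped Pointwise

namespace NumberField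

section

variable (K : Type*) [Field K] [NumberField K]

theorem lseries_term_card_absNorm_eq {s : ℝ} (hs : s ≠ 0) (n : ℕ) :
    LSeries.term (fun n ↦ Nat.card {I : Ideal (𝓞 K) // Ideal.absNorm I = n}) s n =
      ((∑' I : {I : Ideal (𝓞 K) // Ideal.absNorm I = n}, (Ideal.absNorm I.1 : ℝ) ^ (-s) : ℝ) : ℂ)
    := by
  have : ∀ I : {I : Ideal (𝓞 K) // Ideal.absNorm I = n},
      (Ideal.absNorm I.1 : ℝ) ^ (-s) = (n : ℝ) ^ (-s) := fun I ↦ by rw [I.2]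
  simp_rw [this, tsum_const]
  rcases eq_or_ne n 0 with rfl | hn
  · simp [Real.zero_rpow (neg_ne_zero.2 hs)]
  · rw [LSeries.term_of_ne_zero hn, nsmul_eq_mul, Complex.ofReal_mul,
      Complex.ofReal_cpow (Nat.cast_nonneg n), Complex.ofReal_neg, Complex.cpow_neg, div_eq_mul_inv]
    simp

theorem summable_absNorm_rpow_iff {s : ℝ} (hs : s ≠ 0) :
    (Summable fun I : Ideal (𝓞 K) ↦ (Ideal.absNorm I : ℝ) ^ (-s)) ↔
      LSeriesSummable (fun n ↦ Nat.card {I : Ideal (𝓞 K) // Ideal.absNorm I = n}) s := by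
  rw [← (Equiv.sigmaFiberEquiv (Ideal.absNorm (S := 𝓞 K))).summable_iff,
    summable_sigma_of_nonneg (by intro; simp only [Function.comp_apply]; positivity),
    LSeriesSummable, funext (lseries_term_card_absNorm_eq K hs), Complex.summable_ofReal]
  refine and_iff_right fun n ↦ ?_
  have : Finite {I : Ideal (𝓞 K) // Ideal.absNorm I = n} := Ideal.finite_setOfPred_absNorm_eq n
  exact Summable.of_finite

theorem dedekindZeta_eq_tsum {s : ℝ}
    (h : Summable fun I : Ideal (𝓞 K) ↦ (Ideal.absNorm I : ℝ) ^ (-s)) (hs : s ≠ 0) :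
    dedekindZeta K s = ((∑' I : Ideal (𝓞 K), (Ideal.absNorm I : ℝ) ^ (-s) : ℝ) : ℂ) := by
  have e : ∑' I : Ideal (𝓞 K), (Ideal.absNorm I : ℝ) ^ (-s) =
      ∑' n, ∑' I : {I : Ideal (𝓞 K) // Ideal.absNorm I = n}, (Ideal.absNorm I.1 : ℝ) ^ (-s) := by
    rw [← (Equiv.sigmaFiberEquiv (Ideal.absNorm (S := 𝓞 K))).tsum_eq]
    exact ((Equiv.sigmaFiberEquiv (Ideal.absNorm (S := 𝓞 K))).summable_iff.2 h).tsum_sigma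
  rw [e, dedekindZeta, LSeries, funext (lseries_term_card_absNorm_eq K hs), Complex.ofReal_tsum]

theorem summable_absNorm_rpow {s : ℝ} (hs : 1 < s) :
    Summable fun I : Ideal (𝓞 K) ↦ (Ideal.absNorm I : ℝ) ^ (-s) := by
  have h := (tendsto_sub_one_mul_dedekindZeta_nhdsGT K).eventually_ne
    (Complex.ofReal_ne_zero.2 (dedekindZeta_residue_ne_zero K))
  obtain ⟨t, ht, ht1, hts⟩ := (h.and (Ioo_mem_nhdsGT hs)).exists
  rw [summable_absNorm_rpow_iff K (by linarith)]
  refine LSeriesSummable.of_re_le_re (s := t) (by simpa using hts.le) ?_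
  by_contra hsum
  exact ht (by rw [dedekindZeta, LSeries.eq_zero_of_not_LSeriesSummable _ _ hsum, mul_zero])

theorem tendsto_sub_one_mul_tsum_absNorm_rpow :
    Tendsto (fun s : ℝ ↦ (s - 1) * ∑' I : Ideal (𝓞 K), (Ideal.absNorm I : ℝ) ^ (-s)) (𝓝[>] 1)
      (𝓝 (dedekindZeta_residue K)) := by
  refine ((Complex.continuous_re.tendsto _).comp
    (tendsto_sub_one_mul_dedekindZeta_nhdsGT K)).congr' ?_
  filter_upwards [self_mem_nhdsWithin] with s (hs : 1 < s)
  rw [Function.comp_apply, dedekindZeta_eq_tsum K (summable_absNorm_rpow K hs) (by linarith),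
    Complex.re_mul_ofReal]
  simp

variable {K}

theorem one_lt_absNorm (P : HeightOneSpectrum (𝓞 K)) : 1 < Ideal.absNorm P.asIdeal := by
  have h0 : Ideal.absNorm P.asIdeal ≠ 0 := by simpa [Ideal.absNorm_eq_zero_iff] using P.ne_bot
  have h1 : Ideal.absNorm P.asIdeal ≠ 1 := by
    simpa [Ideal.absNorm_eq_one_iff] using P.isPrime.ne_top
  lia

open scoped Classical in
/-- The sum over the ideals coprime to a finite set of primes. -/
theorem tsum_absNorm_rpow_not_dvd {s : ℝ} (hs : 1 < s) (T : Finset (HeightOneSpectrum (𝓞 K))) :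
    (∑' I : Ideal (𝓞 K), if ∀ P ∈ T, ¬ P.asIdeal ∣ I then (Ideal.absNorm I : ℝ) ^ (-s) else 0) =
      (∑' I : Ideal (𝓞 K), (Ideal.absNorm I : ℝ) ^ (-s)) *
        ∏ P ∈ T, (1 - (Ideal.absNorm P.asIdeal : ℝ) ^ (-s)) := by
  have hsum := summable_absNorm_rpow K hs
  have hsum' (p : Ideal (𝓞 K) → Prop) [DecidablePred p] :
      Summable fun I : Ideal (𝓞 K) ↦ if p I then (Ideal.absNorm I : ℝ) ^ (-s) else 0 := by
    refine hsum.of_nonneg_of_le (fun I ↦ ?_) fun I ↦ ?_ <;> split_ifs <;> first | positivity | rfl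
  induction T using Finset.induction_on with
  | empty => simp
  | insert Q T hQ ih =>
    have key : (∑' I : Ideal (𝓞 K), if (∀ P ∈ T, ¬ P.asIdeal ∣ I) ∧ Q.asIdeal ∣ I then
        (Ideal.absNorm I : ℝ) ^ (-s) else 0) = (Ideal.absNorm Q.asIdeal : ℝ) ^ (-s) *
        ∑' I : Ideal (𝓞 K), if ∀ P ∈ T, ¬ P.asIdeal ∣ I then (Ideal.absNorm I : ℝ) ^ (-s) else 0
        := by
      have hinj : Function.Injective fun J : Ideal (𝓞 K) ↦ Q.asIdeal * J :=
        fun _ _ h ↦ mul_left_cancel₀ Q.ne_bot h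
      rw [← tsum_mul_left, ← hinj.tsum_eq]
      · refine tsum_congr fun J ↦ ?_
        have : (∀ P ∈ T, ¬ P.asIdeal ∣ Q.asIdeal * J) ↔ ∀ P ∈ T, ¬ P.asIdeal ∣ J := by
          refine forall₂_congr fun P hP ↦ not_congr
            ⟨fun h ↦ (P.prime.dvd_or_dvd h).resolve_left fun h ↦ hQ ?_, (Dvd.dvd.mul_left · _)⟩
          have := Q.isMaximal.eq_of_le P.isPrime.ne_top (Ideal.dvd_iff_le.1 h)
          rwa [HeightOneSpectrum.ext this]
        simp only [this, dvd_mul_right, and_true, map_mul, Nat.cast_mul, mul_ite, mul_zero]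
        rw [Real.mul_rpow (by positivity) (by positivity)]
      · intro I hI
        obtain ⟨J, rfl⟩ : Q.asIdeal ∣ I := by
          by_contra h
          simp [h] at hI
        exact ⟨J, rfl⟩
    rw [Finset.prod_insert hQ, mul_left_comm, ← ih, sub_mul, one_mul, ← key,
      ← (hsum' _).tsum_sub (hsum' _)]
    refine tsum_congr fun I ↦ ?_
    by_cases h1 : ∀ P ∈ T, ¬ P.asIdeal ∣ I <;> by_cases h2 : Q.asIdeal ∣ I <;> simp [h1, h2]

/-- The Euler product of the Dedekind zeta function, in logarithmic form. -/
theorem hasSum_neg_log_one_sub_absNorm_rpow {s : ℝ} (hs : 1 < s) :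
    HasSum (fun P : HeightOneSpectrum (𝓞 K) ↦
        -Real.log (1 - (Ideal.absNorm P.asIdeal : ℝ) ^ (-s)))
      (Real.log (∑' I : Ideal (𝓞 K), (Ideal.absNorm I : ℝ) ^ (-s))) := by
  classical
  have hsum := summable_absNorm_rpow K hs
  set Z := ∑' I : Ideal (𝓞 K), (Ideal.absNorm I : ℝ) ^ (-s) with hZ
  have hZpos : 0 < Z := hsum.tsum_pos (fun _ ↦ by positivity) ⊤ (by simp)
  have hpos (P : HeightOneSpectrum (𝓞 K)) : 0 < 1 - (Ideal.absNorm P.asIdeal : ℝ) ^ (-s) :=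
    sub_pos.2 (Real.rpow_lt_one_of_one_lt_of_neg (by exact_mod_cast one_lt_absNorm P)
      (by linarith))
  have hlim : Tendsto (fun T : Finset (HeightOneSpectrum (𝓞 K)) ↦
      ∑' I : Ideal (𝓞 K), if ∀ P ∈ T, ¬ P.asIdeal ∣ I then (Ideal.absNorm I : ℝ) ^ (-s) else 0)
      atTop (𝓝 (∑' I : Ideal (𝓞 K), if I = ⊤ then 1 else 0)) := by
    refine tendsto_tsum_of_dominated_convergence hsum (fun I ↦ ?_) (.of_forall fun T I ↦ ?_)
    · rcases eq_or_ne I ⊤ with rfl | hI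
      · refine tendsto_const_nhds.congr fun T ↦ ?_
        have (P : HeightOneSpectrum (𝓞 K)) : ¬ P.asIdeal ∣ ⊤ := fun h ↦
          P.isPrime.ne_top (top_le_iff.1 (Ideal.dvd_iff_le.1 h))
        simp [this]
      · rw [if_neg hI]
        rcases eq_or_ne I ⊥ with rfl | hI0
        · refine tendsto_const_nhds.congr fun T ↦ ?_
          simp [Real.zero_rpow (show -s ≠ 0 by linarith)]
        obtain ⟨M, hM, hIM⟩ := Ideal.exists_le_maximal I hI
        let P : HeightOneSpectrum (𝓞 K) := ⟨M, hM.isPrime, ne_bot_of_le_ne_bot hI0 hIM⟩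
        refine tendsto_const_nhds.congr' ?_
        filter_upwards [eventually_ge_atTop {P}] with T hT
        rw [if_neg]
        exact fun h ↦ h P (hT (by simp)) (Ideal.dvd_iff_le.2 hIM)
    · split_ifs
      · rw [Real.norm_of_nonneg (by positivity)]
      · simp only [norm_zero]; positivity
  simp_rw [tsum_absNorm_rpow_not_dvd hs, ← hZ, tsum_ite_eq] at hlim
  have := (hlim.log one_ne_zero).const_sub (Real.log Z)
  rw [Real.log_one, sub_zero] at this
  refine this.congr fun T ↦ ?_
  rw [Real.log_mul hZpos.ne' (Finset.prod_pos fun P _ ↦ hpos P).ne',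
    Real.log_prod fun P _ ↦ (hpos P).ne', Finset.sum_neg_distrib]
  ring

theorem summable_absNorm_asIdeal_rpow {s : ℝ} (hs : 1 < s) :
    Summable fun P : HeightOneSpectrum (𝓞 K) ↦ (Ideal.absNorm P.asIdeal : ℝ) ^ (-s) :=
  (summable_absNorm_rpow K hs).comp_injective
    (i := fun P : HeightOneSpectrum (𝓞 K) ↦ P.asIdeal) fun _ _ ↦ HeightOneSpectrum.ext

theorem le_neg_log_one_sub {x : ℝ} (hx : x < 1) : x ≤ -Real.log (1 - x) := by
  linarith [Real.log_le_sub_one_of_pos (sub_pos.2 hx)]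

theorem neg_log_one_sub_le {x : ℝ} (hx : x ≤ 1 / 2) :
    -Real.log (1 - x) ≤ x + 2 * x ^ 2 := by
  have h := Real.one_sub_inv_le_log_of_pos (show 0 < 1 - x by linarith)
  have : (1 - x)⁻¹ ≤ 1 + x + 2 * x ^ 2 := by
    rw [inv_le_iff_one_le_mul₀ (by linarith)]
    nlinarith [mul_nonneg (sq_nonneg x) (sub_nonneg.2 hx)]
  linarith

variable (K) in
/-- The sum `∑ N(P)⁻ˢ` over all primes of a number field is `-log (s - 1) + O(1)` as `s → 1⁺`. -/
theorem primeIdealZetaSum_univ_add_log_isBigO :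
    (fun s ↦ (Set.univ : Set (HeightOneSpectrum (𝓞 K))).primeIdealZetaSum s + Real.log (s - 1))
      =O[𝓝[>] 1] (fun _ ↦ (1 : ℝ)) := by
  have h1 : (fun s : ℝ ↦ Real.log
      ((s - 1) * ∑' I : Ideal (𝓞 K), (Ideal.absNorm I : ℝ) ^ (-s))) =O[𝓝[>] 1]
      (fun _ ↦ (1 : ℝ)) :=
    ((tendsto_sub_one_mul_tsum_absNorm_rpow K).log (dedekindZeta_residue_ne_zero K)).isBigO_one ℝ
  have h2 : (fun s : ℝ ↦ (Set.univ : Set (HeightOneSpectrum (𝓞 K))).primeIdealZetaSum s -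
      Real.log (∑' I : Ideal (𝓞 K), (Ideal.absNorm I : ℝ) ^ (-s))) =O[𝓝[>] 1]
      (fun _ ↦ (1 : ℝ)) := by
    refine IsBigO.of_bound (∑' P : HeightOneSpectrum (𝓞 K),
      2 * (Ideal.absNorm P.asIdeal : ℝ) ^ (-2 : ℝ)) ?_
    filter_upwards [self_mem_nhdsWithin] with s (hs : 1 < s)
    have hN (P : HeightOneSpectrum (𝓞 K)) : (2 : ℝ) ≤ Ideal.absNorm P.asIdeal := by
      exact_mod_cast one_lt_absNorm P
    have hx (P : HeightOneSpectrum (𝓞 K)) :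
        (Ideal.absNorm P.asIdeal : ℝ) ^ (-s) ≤ (Ideal.absNorm P.asIdeal : ℝ) ^ (-1 : ℝ) :=
      Real.rpow_le_rpow_of_exponent_le (by linarith [hN P]) (by linarith)
    have hx' (P : HeightOneSpectrum (𝓞 K)) : (Ideal.absNorm P.asIdeal : ℝ) ^ (-s) ≤ 1 / 2 := by
      refine (hx P).trans ?_
      rw [Real.rpow_neg_one, one_div]
      exact inv_anti₀ (by norm_num) (hN P)
    have hsq (P : HeightOneSpectrum (𝓞 K)) :
        ((Ideal.absNorm P.asIdeal : ℝ) ^ (-s)) ^ 2 ≤ (Ideal.absNorm P.asIdeal : ℝ) ^ (-2 : ℝ) := by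
      rw [← Real.rpow_mul_natCast (by positivity)]
      exact Real.rpow_le_rpow_of_exponent_le (by linarith [hN P]) (by push_cast; linarith)
    have e := hasSum_neg_log_one_sub_absNorm_rpow (K := K) hs
    have e1 := summable_absNorm_asIdeal_rpow (K := K) hs
    have e2 := (summable_absNorm_asIdeal_rpow (K := K) one_lt_two).mul_left 2
    rw [Set.primeIdealZetaSum_def, tsum_univ fun P : HeightOneSpectrum (𝓞 K) ↦
      (Ideal.absNorm P.asIdeal : ℝ) ^ (-s), norm_one, mul_one, Real.norm_eq_abs, abs_le]
    have a := e1.tsum_le_tsum (fun P ↦ le_neg_log_one_sub (by linarith [hx' P])) e.summable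
    have b := e.summable.tsum_le_tsum (fun P ↦ (neg_log_one_sub_le (hx' P)).trans
      (add_le_add_right (mul_le_mul_of_nonneg_left (hsq P) zero_le_two) _)) (e1.add e2)
    rw [e.tsum_eq] at a b
    rw [e1.tsum_add e2] at b
    have c : 0 ≤ ∑' P : HeightOneSpectrum (𝓞 K), 2 * (Ideal.absNorm P.asIdeal : ℝ) ^ (-2 : ℝ) :=
      tsum_nonneg fun _ ↦ by positivity
    constructor <;> linarith
  refine (h1.add h2).congr' ?_ .rfl
  filter_upwards [self_mem_nhdsWithin] with s (hs : 1 < s)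
  rw [Real.log_mul (sub_ne_zero.2 hs.ne')
    ((summable_absNorm_rpow K hs).tsum_pos (fun _ ↦ by positivity) ⊤ (by simp)).ne']
  ring

end

section

variable (K : Type*) [Field K] [NumberField K] (M : Type*) [Field M] [NumberField M] [Algebra K M]

theorem finite_setOf_ramificationIdx_ne_one :
    {P : HeightOneSpectrum (𝓞 M) | P.asIdeal.ramificationIdx (𝓞 K) ≠ 1}.Finite := by
  refine (Ideal.finite_factors (differentIdeal_ne_bot (A := 𝓞 K) (B := 𝓞 M))).subset ?_
  intro P hP
  by_contra h
  have := (not_dvd_differentIdeal_iff (A := 𝓞 K) (B := 𝓞 M) (P := P.asIdeal)).1 h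
  exact hP (Ideal.ramificationIdx_eq_one _ _)

variable {K}

/-- The primes of `M` above a prime `Q` of `K`. -/
noncomputable def fiberUnderEquivPrimesOver (Q : HeightOneSpectrum (𝓞 K)) :
    {P : HeightOneSpectrum (𝓞 M) // P.under (𝓞 K) = Q} ≃ Q.asIdeal.primesOver (𝓞 M) where
  toFun P := ⟨P.1.asIdeal, P.1.isPrime, ⟨congrArg HeightOneSpectrum.asIdeal P.2.symm⟩⟩
  invFun P := ⟨⟨P.1, P.2.1, Ideal.ne_bot_of_mem_primesOver Q.ne_bot P.2⟩,
    HeightOneSpectrum.ext P.2.2.over.symm⟩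
  left_inv _ := rfl
  right_inv _ := rfl

instance (Q : HeightOneSpectrum (𝓞 K)) :
    Finite {P : HeightOneSpectrum (𝓞 M) // P.under (𝓞 K) = Q} :=
  have := Q.isMaximal
  .of_equiv _ (fiberUnderEquivPrimesOver M Q).symm

variable {M} in
instance (P : HeightOneSpectrum (𝓞 M)) : P.asIdeal.LiesOver (P.under (𝓞 K)).asIdeal := ⟨rfl⟩

theorem card_fiber_under_eq_sum (Q : HeightOneSpectrum (𝓞 K))
    [Fintype (Q.asIdeal.primesOver (𝓞 M))] :
    ∑ P : Q.asIdeal.primesOver (𝓞 M), P.1.ramificationIdx (𝓞 K) * P.1.inertiaDeg (𝓞 K) =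
      Module.finrank K M := by
  rw [Ideal.sum_ramification_inertia_eq_finrank, IsFractionRing.finrank_eq (𝓞 K) K (𝓞 M) M]

theorem card_fiber_under_le (Q : HeightOneSpectrum (𝓞 K)) :
    Nat.card {P : HeightOneSpectrum (𝓞 M) // P.under (𝓞 K) = Q} ≤ Module.finrank K M := by
  have := Q.isMaximal
  rw [Nat.card_congr (fiberUnderEquivPrimesOver M Q), ← card_fiber_under_eq_sum M Q,
    Nat.card_eq_fintype_card, Fintype.card_eq_sum_ones]
  refine Finset.sum_le_sum fun P _ ↦ ?_
  have := P.2.1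
  have := P.2.2
  exact Nat.mul_pos (Ideal.ramificationIdx_pos ..) (Ideal.inertiaDeg_pos ..)

theorem card_fiber_under_eq (Q : HeightOneSpectrum (𝓞 K))
    (h : ∀ P : HeightOneSpectrum (𝓞 M), P.under (𝓞 K) = Q →
      P.asIdeal.ramificationIdx (𝓞 K) * P.asIdeal.inertiaDeg (𝓞 K) = 1) :
    Nat.card {P : HeightOneSpectrum (𝓞 M) // P.under (𝓞 K) = Q} = Module.finrank K M := by
  have := Q.isMaximal
  rw [Nat.card_congr (fiberUnderEquivPrimesOver M Q), ← card_fiber_under_eq_sum M Q,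
    Nat.card_eq_fintype_card, Fintype.card_eq_sum_ones]
  refine Finset.sum_congr rfl fun P _ ↦ ?_
  exact (h _ ((fiberUnderEquivPrimesOver M Q).symm P).2).symm

theorem summable_comp_under {g : HeightOneSpectrum (𝓞 K) → ℝ} (hg : Summable g) (hg0 : 0 ≤ g) :
    Summable fun P : HeightOneSpectrum (𝓞 M) ↦ g (P.under (𝓞 K)) := by
  rw [← (Equiv.sigmaFiberEquiv (HeightOneSpectrum.under (𝓞 K) (B := 𝓞 M))).summable_iff,
    summable_sigma_of_nonneg (by intro; exact hg0 _)]
  refine ⟨fun _ ↦ Summable.of_finite, (hg.mul_left (Module.finrank K M : ℝ)).of_nonneg_of_le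
    (fun _ ↦ tsum_nonneg fun _ ↦ hg0 _) fun Q ↦ ?_⟩
  have : ∀ P : {P : HeightOneSpectrum (𝓞 M) // P.under (𝓞 K) = Q}, g (P.1.under (𝓞 K)) = g Q :=
    fun P ↦ by rw [P.2]
  simp only [Function.comp_apply, Equiv.sigmaFiberEquiv_apply, this, tsum_const, nsmul_eq_mul]
  exact mul_le_mul_of_nonneg_right (by exact_mod_cast card_fiber_under_le M Q) (hg0 Q)

theorem tsum_comp_under {g : HeightOneSpectrum (𝓞 K) → ℝ} (hg : Summable g) (hg0 : 0 ≤ g) :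
    ∑' P : HeightOneSpectrum (𝓞 M), g (P.under (𝓞 K)) =
      ∑' Q, Nat.card {P : HeightOneSpectrum (𝓞 M) // P.under (𝓞 K) = Q} * g Q := by
  have h := (Equiv.sigmaFiberEquiv (HeightOneSpectrum.under (𝓞 K) (B := 𝓞 M))).summable_iff.2
    (summable_comp_under M hg hg0)
  rw [← (Equiv.sigmaFiberEquiv (HeightOneSpectrum.under (𝓞 K) (B := 𝓞 M))).tsum_eq]
  refine h.tsum_sigma.trans (tsum_congr fun Q ↦ ?_)
  have : ∀ P : {P : HeightOneSpectrum (𝓞 M) // P.under (𝓞 K) = Q}, g (P.1.under (𝓞 K)) = g Q :=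
    fun P ↦ by rw [P.2]
  simp only [Function.comp_apply, Equiv.sigmaFiberEquiv_apply, this, tsum_const, nsmul_eq_mul]

/-- If the primes of `K` in `T` split completely in `M` and no prime of `M` above a prime not in `T`
has relative degree one, then the prime zeta sums of `M` and of `T` agree up to the factor `[M : K]`
and a bounded error. -/
theorem primeIdealZetaSum_univ_sub_isBigO (T : Set (HeightOneSpectrum (𝓞 K)))
    (hT : ∀ P : HeightOneSpectrum (𝓞 M), P.under (𝓞 K) ∈ T ↔
      P.asIdeal.ramificationIdx (𝓞 K) * P.asIdeal.inertiaDeg (𝓞 K) = 1) :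
    (fun s ↦ (Set.univ : Set (HeightOneSpectrum (𝓞 M))).primeIdealZetaSum s -
      Module.finrank K M * T.primeIdealZetaSum s) =O[𝓝[>] 1] (fun _ ↦ (1 : ℝ)) := by
  classical
  set E := {P : HeightOneSpectrum (𝓞 M) | P.asIdeal.ramificationIdx (𝓞 K) ≠ 1}
  have hE : E.Finite := finite_setOf_ramificationIdx_ne_one K M
  have hE1 : Summable (E.indicator (1 : HeightOneSpectrum (𝓞 M) → ℝ)) :=
    summable_of_hasFiniteSupport (hE.subset Set.support_indicator_subset)
  have hE2 := summable_comp_under M (summable_absNorm_asIdeal_rpow (K := K) one_lt_two)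
    fun _ ↦ by positivity
  refine IsBigO.of_bound (∑' P : HeightOneSpectrum (𝓞 M),
    (E.indicator (1 : HeightOneSpectrum (𝓞 M) → ℝ) P +
      (Ideal.absNorm (P.under (𝓞 K)).asIdeal : ℝ) ^ (-2 : ℝ))) ?_
  filter_upwards [self_mem_nhdsWithin] with s (hs : 1 < s)
  set G := T.indicator fun Q : HeightOneSpectrum (𝓞 K) ↦ (Ideal.absNorm Q.asIdeal : ℝ) ^ (-s)
  have hG0 : 0 ≤ G := Set.indicator_nonneg fun _ _ ↦ by positivity
  have hG : Summable G := (summable_absNorm_asIdeal_rpow hs).indicator T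
  have hfin : Module.finrank K M * T.primeIdealZetaSum s =
      ∑' P : HeightOneSpectrum (𝓞 M), G (P.under (𝓞 K)) := by
    rw [tsum_comp_under M hG hG0, Set.primeIdealZetaSum_def, tsum_subtype T
      fun Q : HeightOneSpectrum (𝓞 K) ↦ (Ideal.absNorm Q.asIdeal : ℝ) ^ (-s), ← tsum_mul_left]
    refine tsum_congr fun Q ↦ ?_
    by_cases hQ : Q ∈ T
    · rw [card_fiber_under_eq M Q fun P hP ↦ (hT P).1 (hP ▸ hQ)]
    · simp [G, hQ]
  have hM := summable_absNorm_asIdeal_rpow (K := M) hs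
  rw [hfin, Set.primeIdealZetaSum_def, tsum_univ fun P : HeightOneSpectrum (𝓞 M) ↦
    (Ideal.absNorm P.asIdeal : ℝ) ^ (-s), ← hM.tsum_sub (summable_comp_under M hG hG0),
    norm_one, mul_one]
  refine tsum_of_norm_bounded (hE1.add hE2).hasSum fun P ↦ ?_
  have hN := Ideal.absNorm_pow_inertiaDeg (P.under (𝓞 K)).asIdeal P.asIdeal
  have hN2 : (1 : ℝ) < Ideal.absNorm (P.under (𝓞 K)).asIdeal := by
    exact_mod_cast one_lt_absNorm (P.under (𝓞 K))
  by_cases hP : P.under (𝓞 K) ∈ T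
  · rw [Nat.eq_one_of_mul_eq_one_left ((hT P).1 hP), pow_one] at hN
    simp only [G, Set.indicator_of_mem hP, hN, sub_self, norm_zero]
    exact add_nonneg (Set.indicator_nonneg (by simp) _) (by positivity)
  · simp only [G, Set.indicator_of_notMem hP, sub_zero]
    rw [Real.norm_of_nonneg (by positivity)]
    by_cases hPE : P ∈ E
    · rw [Set.indicator_of_mem hPE]
      refine le_add_of_le_of_nonneg (Real.rpow_le_one_of_one_le_of_nonpos ?_ (by linarith))
        (by positivity)
      exact_mod_cast (one_lt_absNorm P).le
    · rw [Set.indicator_of_notMem hPE, zero_add, ← hN]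
      have he : P.asIdeal.ramificationIdx (𝓞 K) = 1 := not_not.1 hPE
      rw [hT, he, one_mul] at hP
      have hf : 2 ≤ P.asIdeal.inertiaDeg (𝓞 K) := by
        have : 0 < P.asIdeal.inertiaDeg (𝓞 K) := Ideal.inertiaDeg_pos ..
        lia
      rw [Nat.cast_pow, ← Real.rpow_natCast_mul (by positivity)]
      refine Real.rpow_le_rpow_of_exponent_le hN2.le ?_
      have : (2 : ℝ) ≤ P.asIdeal.inertiaDeg (𝓞 K) := by exact_mod_cast hf
      nlinarith

/-- If exactly the primes of `K` in `T` split completely in `M`, and the others have no factor of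
degree one in `M`, then `T` has Dirichlet density `1 / [M : K]`. -/
theorem finrank_mul_primeIdealZetaSum_add_log_isBigO (T : Set (HeightOneSpectrum (𝓞 K)))
    (hT : ∀ P : HeightOneSpectrum (𝓞 M), P.under (𝓞 K) ∈ T ↔
      P.asIdeal.ramificationIdx (𝓞 K) * P.asIdeal.inertiaDeg (𝓞 K) = 1) :
    (fun s ↦ Module.finrank K M * T.primeIdealZetaSum s + Real.log (s - 1)) =O[𝓝[>] 1]
      (fun _ ↦ (1 : ℝ)) :=
  ((primeIdealZetaSum_univ_add_log_isBigO M).sub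
    (primeIdealZetaSum_univ_sub_isBigO M T hT)).congr_left fun _ ↦ by ring

end

end NumberField

theorem IsCyclic.le_of_card_dvd_card {G : Type*} [Group G] [Finite G] [IsCyclic G]
    {H D : Subgroup G} (h : Nat.card H ∣ Nat.card D) : H ≤ D := by
  classical
  have := Fintype.ofFinite G
  have hsub : (D : Set G).toFinset ⊆ ({a : G | a ^ Nat.card D = 1} : Finset G) := fun a ha ↦ by
    simpa using orderOf_dvd_iff_pow_eq_one.1
      (D.orderOf_dvd_natCard (Set.mem_toFinset.1 ha))
  have heq := Finset.eq_of_subset_of_card_le hsub <| by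
    refine (IsCyclic.card_pow_eq_one_le Nat.card_pos).trans_eq ?_
    rw [Set.toFinset_card, ← Nat.card_eq_fintype_card]
    rfl
  intro x hx
  have : x ∈ (D : Set G).toFinset := by
    rw [heq]
    simpa using orderOf_dvd_iff_pow_eq_one.1 ((H.orderOf_dvd_natCard hx).trans h)
  exact Set.mem_toFinset.1 this

theorem IsCyclic.exists_subgroup_card_eq {G : Type*} [Group G] [Finite G] [IsCyclic G] {d : ℕ}
    (hd : d ∣ Nat.card G) : ∃ D : Subgroup G, Nat.card D = d := by
  obtain ⟨g, hg⟩ := IsCyclic.exists_ofOrder_eq_natCard (α := G)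
  obtain ⟨m, hm⟩ := hd
  have hm0 : m ≠ 0 := by
    rintro rfl
    exact Nat.card_pos.ne' (hm.trans (mul_zero d))
  refine ⟨Subgroup.zpowers (g ^ m), ?_⟩
  rw [Nat.card_zpowers, orderOf_pow_of_dvd hm0 (by rw [hg, hm]; exact dvd_mul_left m d), hg, hm,
    Nat.mul_div_cancel _ (Nat.pos_of_ne_zero hm0)]

namespace NumberField

section tower

variable {K M L G : Type*} [Field K] [NumberField K] [Field M] [NumberField M]
  [Field L] [NumberField L] [Algebra K M] [Algebra M L] [Algebra K L] [IsScalarTower K M L]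
  [Group G] [Finite G] [MulSemiringAction G (𝓞 L)] [IsGaloisGroup G (𝓞 K) (𝓞 L)]

instance (Q : HeightOneSpectrum (𝓞 K)) : PerfectField Q.asIdeal.ResidueField :=
  have := Q.isMaximal
  have : Finite (𝓞 K ⧸ Q.asIdeal) := Ideal.finiteQuotientOfFreeOfNeBot _ Q.ne_bot
  have : Finite Q.asIdeal.ResidueField :=
    .of_surjective _ (Ideal.bijective_algebraMap_quotient_residueField Q.asIdeal).2
  inferInstance

variable (K G) in
theorem card_stabilizer_eq (P : HeightOneSpectrum (𝓞 L)) :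
    Nat.card (MulAction.stabilizer G P.asIdeal) =
      P.asIdeal.ramificationIdx (𝓞 K) * P.asIdeal.inertiaDeg (𝓞 K) := by
  rw [Ideal.card_stabilizer_eq (P.under (𝓞 K)).asIdeal P.asIdeal,
    Ideal.ramificationIdxIn_eq_ramificationIdx _ P.asIdeal G,
    Ideal.inertiaDegIn_eq_inertiaDeg _ P.asIdeal G]

theorem ramificationIdx_mul_inertiaDeg_under_eq_one_iff (D : Subgroup G)
    [IsGaloisGroup D (𝓞 M) (𝓞 L)] (P : HeightOneSpectrum (𝓞 L)) :
    (P.under (𝓞 M)).asIdeal.ramificationIdx (𝓞 K) * (P.under (𝓞 M)).asIdeal.inertiaDeg (𝓞 K) = 1 ↔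
      MulAction.stabilizer G P.asIdeal ≤ D := by
  have h1 := card_stabilizer_eq K G P
  have h2 : Nat.card (MulAction.stabilizer G P.asIdeal ⊓ D : Subgroup G) =
      P.asIdeal.ramificationIdx (𝓞 M) * P.asIdeal.inertiaDeg (𝓞 M) := by
    rw [← card_stabilizer_eq M D P]
    exact Nat.card_congr
      { toFun x := ⟨⟨x.1, x.2.2⟩, x.2.1⟩
        invFun x := ⟨x.1.1, x.2, x.1.2⟩ }
  rw [Ideal.ramificationIdx_tower (P.under (𝓞 M)).asIdeal P.asIdeal,
    Ideal.inertiaDeg_tower (P.under (𝓞 M)).asIdeal P.asIdeal, mul_mul_mul_comm, ← h2] at h1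
  rw [← inf_eq_left]
  constructor
  · intro h
    rw [h, one_mul] at h1
    exact Subgroup.eq_of_le_of_card_ge inf_le_left h1.le
  · intro h
    rw [h] at h1
    exact Nat.eq_of_mul_eq_mul_right Nat.card_pos (by rw [one_mul, ← h1])

end tower

theorem exists_under_eq (K : Type*) {M : Type*} [Field K] [NumberField K] [Field M] [NumberField M]
    [Algebra K M] (Q : HeightOneSpectrum (𝓞 K)) :
    ∃ P : HeightOneSpectrum (𝓞 M), P.under (𝓞 K) = Q := by
  obtain ⟨P, hP, h⟩ :=
    Q.asIdeal.exists_ideal_over_prime_of_isIntegral_of_isDomain (S := 𝓞 M) (by simp)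
  refine ⟨⟨P, hP, ?_⟩, HeightOneSpectrum.ext h⟩
  rintro rfl
  exact Q.ne_bot (by simp [← h])

section cyclic

variable {K L : Type*} [Field K] [NumberField K] [Field L] [Algebra K L]

variable (K L) in
/-- The order of the decomposition groups above a prime of `K` in a Galois extension `L / K`. -/
noncomputable def decompositionCard (Q : HeightOneSpectrum (𝓞 K)) : ℕ :=
  Q.asIdeal.ramificationIdxIn (𝓞 L) * Q.asIdeal.inertiaDegIn (𝓞 L)

theorem primeIdealZetaSum_dvd_eq_sum {d : ℕ} (hd : d ≠ 0) {s : ℝ} (hs : 1 < s) :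
    Set.primeIdealZetaSum {Q | decompositionCard K L Q ∣ d} s =
      ∑ e ∈ d.divisors, Set.primeIdealZetaSum {Q | decompositionCard K L Q = e} s := by
  have h := summable_absNorm_asIdeal_rpow (K := K) hs
  simp only [Set.primeIdealZetaSum_def]
  rw [tsum_subtype {Q | decompositionCard K L Q ∣ d}
    fun Q : HeightOneSpectrum (𝓞 K) ↦ (Ideal.absNorm Q.asIdeal : ℝ) ^ (-s)]
  simp_rw [fun e ↦ tsum_subtype {Q | decompositionCard K L Q = e}
    fun Q : HeightOneSpectrum (𝓞 K) ↦ (Ideal.absNorm Q.asIdeal : ℝ) ^ (-s)]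
  rw [← Summable.tsum_finsetSum fun e _ ↦ h.indicator _]
  refine tsum_congr fun Q ↦ ?_
  simp [Set.indicator_apply, hd]

variable (G : Type*) [NumberField L] [Group G] [Finite G] [MulSemiringAction G L] [IsGaloisGroup G K L]

theorem decompositionCard_under (P : HeightOneSpectrum (𝓞 L)) :
    decompositionCard K L (P.under (𝓞 K)) = Nat.card (MulAction.stabilizer G P.asIdeal) :=
  (Ideal.card_stabilizer_eq (P.under (𝓞 K)).asIdeal P.asIdeal).symm

theorem card_mul_primeIdealZetaSum_dvd_add_log_isBigO [IsCyclic G] {d : ℕ} (hd : d ∣ Nat.card G) :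
    (fun s ↦ Nat.card G * Set.primeIdealZetaSum {Q | decompositionCard K L Q ∣ d} s +
      d * Real.log (s - 1)) =O[𝓝[>] 1] (fun _ ↦ (1 : ℝ)) := by
  obtain ⟨D, rfl⟩ := IsCyclic.exists_subgroup_card_eq hd
  let M : IntermediateField K L := FixedPoints.intermediateField D
  have hML : IsGaloisGroup D M L := inferInstanceAs
    (IsGaloisGroup D (FixedPoints.intermediateField (F := K) (E := L) D) L)
  have : IsGaloisGroup D (𝓞 M) (𝓞 L) := IsGaloisGroup.of_isFractionRing D (𝓞 M) (𝓞 L) M L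
  have hcard : Nat.card G = Nat.card D * Module.finrank K M := by
    rw [IsGaloisGroup.card_eq_finrank G K L, IsGaloisGroup.card_eq_finrank D M L, mul_comm,
      Module.finrank_mul_finrank]
  have h := finrank_mul_primeIdealZetaSum_add_log_isBigO M {Q | decompositionCard K L Q ∣ Nat.card D}
    fun P ↦ by
      obtain ⟨P, rfl⟩ := exists_under_eq M (M := L) P
      rw [ramificationIdx_mul_inertiaDeg_under_eq_one_iff D P]
      have : (P.under (𝓞 M)).under (𝓞 K) = P.under (𝓞 K) :=
        HeightOneSpectrum.ext (Ideal.under_under P.asIdeal)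
      rw [this, Set.mem_ofPred_eq, decompositionCard_under G]
      exact ⟨IsCyclic.le_of_card_dvd_card, Subgroup.card_dvd_of_le⟩
  refine (h.const_mul_left (Nat.card D : ℝ)).congr_left fun s ↦ ?_
  rw [hcard]
  push_cast
  ring

/-- The primes with decomposition group of order `d` in a cyclic extension of degree `n` have
Dirichlet density `φ(d) / n`. -/
theorem card_mul_primeIdealZetaSum_eq_add_log_isBigO [IsCyclic G] {d : ℕ} (hd : d ∣ Nat.card G) :
    (fun s ↦ Nat.card G * Set.primeIdealZetaSum {Q | decompositionCard K L Q = d} s +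
      d.totient * Real.log (s - 1)) =O[𝓝[>] 1] (fun _ ↦ (1 : ℝ)) := by
  induction d using Nat.strong_induction_on with
  | _ d ih =>
  have hd0 : d ≠ 0 := ne_zero_of_dvd_ne_zero Nat.card_pos.ne' hd
  have h := (card_mul_primeIdealZetaSum_dvd_add_log_isBigO (K := K) (L := L) G hd).sub <|
    IsBigO.sum (s := d.properDivisors) fun e he ↦
      ih e (Nat.mem_properDivisors.1 he).2 ((Nat.mem_properDivisors.1 he).1.trans hd)
  refine h.congr' ?_ .rfl
  filter_upwards [self_mem_nhdsWithin] with s (hs : 1 < s)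
  have hφ : (d : ℝ) = ∑ e ∈ d.properDivisors, (e.totient : ℝ) + d.totient := by
    rw [← Nat.cast_sum, ← Nat.cast_add, add_comm, ← Finset.sum_insert Nat.self_notMem_properDivisors,
      Nat.insert_self_properDivisors hd0, Nat.sum_totient]
  rw [primeIdealZetaSum_dvd_eq_sum hd0 hs, ← Nat.insert_self_properDivisors hd0,
    Finset.sum_insert Nat.self_notMem_properDivisors, Finset.sum_apply, Finset.sum_add_distrib, ← Finset.mul_sum,
    ← Finset.sum_mul, hφ]
  ring

theorem infinite_setOf_decompositionCard_eq [IsCyclic G] :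
    {Q : HeightOneSpectrum (𝓞 K) | decompositionCard K L Q = Nat.card G}.Infinite := by
  intro hfin
  have h1 := card_mul_primeIdealZetaSum_eq_add_log_isBigO (K := K) (L := L) G dvd_rfl
  have h2 : (fun s ↦ Nat.card G *
      Set.primeIdealZetaSum {Q | decompositionCard K L Q = Nat.card G} s) =O[𝓝[>] 1]
      (fun _ ↦ (1 : ℝ)) := by
    refine IsBigO.const_mul_left (IsBigO.of_bound
      {Q | decompositionCard K L Q = Nat.card G}.ncard ?_) _
    filter_upwards [self_mem_nhdsWithin] with s (hs : 1 < s)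
    rw [Real.norm_of_nonneg (Set.primeIdealZetaSum_nonneg _ _), norm_one, mul_one]
    exact Set.primeIdealZetaSum_le_card_of_finite hfin (by linarith)
  have h3 := (h1.sub h2).congr_left (fun s ↦ add_sub_cancel_left _ _)
  have h4 : Tendsto (fun s : ℝ ↦ (Nat.card G).totient * Real.log (s - 1)) (𝓝[>] 1) atBot := by
    refine (Real.tendsto_log_nhdsGT_zero.comp ?_).const_mul_atBot
      (by exact_mod_cast Nat.totient_pos.2 Nat.card_pos)
    refine tendsto_nhdsWithin_iff.2 ⟨?_, ?_⟩
    · exact ((continuous_id.sub continuous_const).tendsto' 1 0 (by simp)).mono_left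
        nhdsWithin_le_nhds
    · filter_upwards [self_mem_nhdsWithin] with s (hs : 1 < s) using sub_pos.2 hs
  exact not_isBoundedUnder_of_tendsto_atTop (tendsto_abs_atBot_atTop.comp h4)
    h3.isBoundedUnder_le

end cyclic

theorem finite_setOf_natCast_mem (K : Type*) [Field K] [NumberField K] {n : ℕ} (hn : n ≠ 0) :
    {Q : HeightOneSpectrum (𝓞 K) | (n : 𝓞 K) ∈ Q.asIdeal}.Finite := by
  have h : Ideal.span {(n : 𝓞 K)} ≠ 0 := by simpa using hn
  refine (Ideal.finite_factors h).subset fun Q hQ ↦ ?_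
  simpa [Ideal.dvd_span_singleton] using hQ

theorem exists_prime_natCast_mem {K : Type*} [Field K] [NumberField K]
    (P : HeightOneSpectrum (𝓞 K)) : ∃ p : ℕ, p.Prime ∧ (p : 𝓞 K) ∈ P.asIdeal := by
  have h : ((Ideal.absNorm P.asIdeal : ℕ) : 𝓞 K) ∈ P.asIdeal := Ideal.absNorm_mem _
  have h0 : Ideal.absNorm P.asIdeal ≠ 0 := (zero_lt_one.trans (one_lt_absNorm P)).ne'
  generalize Ideal.absNorm P.asIdeal = n at h h0
  induction n using induction_on_primes with
  | zero => exact absurd rfl h0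
  | one => exact absurd (P.asIdeal.eq_top_iff_one.2 (by simpa using h)) P.isPrime.ne_top
  | prime_mul p a hp ih =>
    rw [Nat.cast_mul] at h
    rcases P.isPrime.mem_or_mem h with h | h
    · exact ⟨p, hp, h⟩
    · exact ih h (right_ne_zero_of_mul h0)

/-- Every automorphism of a Galois number field fixes a prime which does not lie over a prescribed
finite set of rational primes: a form of the Frobenius density theorem. -/
theorem exists_prime_smul_eq (L : Type*) [Field L] [NumberField L] [IsGalois ℚ L] (σ : Gal(L/ℚ))
    (S : Finset ℕ) : ∃ (p : ℕ) (P : HeightOneSpectrum (𝓞 L)), p.Prime ∧ p ∉ S ∧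
      (p : 𝓞 L) ∈ P.asIdeal ∧ σ • P.asIdeal = P.asIdeal := by
  let G := Subgroup.zpowers σ
  let K : IntermediateField ℚ L := FixedPoints.intermediateField G
  have : IsGaloisGroup G K L := inferInstanceAs
    (IsGaloisGroup G (FixedPoints.intermediateField (F := ℚ) (E := L) G) L)
  have : IsGaloisGroup G (𝓞 K) (𝓞 L) := IsGaloisGroup.of_isFractionRing G (𝓞 K) (𝓞 L) K L
  have hfin : (⋃ p ∈ {p ∈ S | p ≠ 0}, {Q : HeightOneSpectrum (𝓞 K) | (p : 𝓞 K) ∈ Q.asIdeal}).Finite :=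
    Set.Finite.biUnion (Finset.finite_toSet _) fun p hp ↦
      finite_setOf_natCast_mem K (Finset.mem_filter.1 hp).2
  obtain ⟨Q, hQ, hQS⟩ :=
    (infinite_setOf_decompositionCard_eq (K := K) (L := L) G).exists_notMem_finite hfin
  obtain ⟨P, rfl⟩ := exists_under_eq K (M := L) Q
  obtain ⟨p, hp, hpP⟩ := exists_prime_natCast_mem P
  refine ⟨p, P, hp, fun hpS ↦ hQS ?_, hpP, ?_⟩
  · simp only [Set.mem_iUnion]
    refine ⟨p, by simp [hpS, hp.ne_zero], ?_⟩
    change algebraMap (𝓞 K) (𝓞 L) p ∈ P.asIdeal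
    simpa using hpP
  · have h := decompositionCard_under (K := K) G P
    rw [hQ] at h
    have := (Subgroup.eq_top_of_card_eq _ h.symm) ▸
      Subgroup.mem_top (⟨σ, Subgroup.mem_zpowers σ⟩ : G)
    exact this

section

variable {p : ℕ} [Fact p.Prime] {L : Type*} [Field L]

theorem norm_natCast_prime_lt_one : ‖(p : PadicAlgCl p)‖ < 1 := by
  have h := PadicAlgCl.norm_extends p p
  rw [map_natCast] at h
  exact h.trans_lt Padic.norm_p_lt_one

theorem norm_map_ringOfIntegers_le_one (j : L →+* PadicAlgCl p) (a : 𝓞 L) : ‖j a‖ ≤ 1 := by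
  have h : IsIntegral ℤ (j a) := a.isIntegral_coe.map (f := j.toIntAlgHom)
  have := (Valuation.integer.integers (Valued.v : Valuation (PadicAlgCl p) _)).mem_of_integral
    (h.tower_top (A := (Valued.v : Valuation (PadicAlgCl p) _).integer))
  exact_mod_cast this

/-- The prime of a number field induced by an embedding into `ℚ̄_p`. -/
noncomputable def padicPrime (j : L →+* PadicAlgCl p) : Ideal (𝓞 L) where
  carrier := {a | ‖j a‖ < 1}
  zero_mem' := by simp
  add_mem' {a b} ha hb := by
    simpa using (PadicAlgCl.isNonarchimedean p (j a) (j b)).trans_lt (max_lt ha hb)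
  smul_mem' c a ha := by
    simpa using mul_lt_one_of_nonneg_of_lt_one_right (norm_map_ringOfIntegers_le_one j c)
      (norm_nonneg _) ha

theorem mem_padicPrime {j : L →+* PadicAlgCl p} {a : 𝓞 L} : a ∈ padicPrime j ↔ ‖j a‖ < 1 := .rfl

instance (j : L →+* PadicAlgCl p) : (padicPrime j).IsPrime where
  ne_top' := by simp [Ideal.ne_top_iff_one, mem_padicPrime]
  mem_or_mem' {a b} h := by
    by_contra! hab
    simp only [mem_padicPrime, not_lt, map_mul, norm_mul] at h hab
    nlinarith

theorem natCast_mem_padicPrime (j : L →+* PadicAlgCl p) : (p : 𝓞 L) ∈ padicPrime j := by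
  simpa [mem_padicPrime] using norm_natCast_prime_lt_one

theorem liesOver_span_of_natCast_mem {P : Ideal (𝓞 L)} [P.IsPrime] (h : (p : 𝓞 L) ∈ P) :
    P.LiesOver (Ideal.span {(p : ℤ)}) :=
  ⟨by
    refine (Int.ideal_span_isMaximal_of_prime p).eq_of_le (Ideal.IsPrime.under ℤ P).ne_top ?_
    rw [Ideal.span_singleton_le_iff_mem]
    simpa [Ideal.mem_comap] using h⟩

variable [NumberField L]

/-- Every prime of a Galois number field above `p` is induced by an embedding into `ℚ̄_p`. -/
theorem exists_padicPrime_eq [IsGalois ℚ L] (P : Ideal (𝓞 L)) [P.IsPrime] (h : (p : 𝓞 L) ∈ P) :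
    ∃ j : L →+* PadicAlgCl p, padicPrime j = P := by
  let j₀ : L →+* PadicAlgCl p := (IsAlgClosed.lift : L →ₐ[ℚ] PadicAlgCl p)
  have := liesOver_span_of_natCast_mem h
  have := liesOver_span_of_natCast_mem (natCast_mem_padicPrime j₀)
  obtain ⟨σ, hσ⟩ := Ideal.exists_smul_eq_of_isGaloisGroup (Ideal.span {(p : ℤ)}) P
    (padicPrime j₀) Gal(L/ℚ)
  refine ⟨j₀.comp (σ : L →+* L), Ideal.ext fun a ↦ ?_⟩
  rw [← Ideal.smul_mem_pointwise_smul_iff (a := σ) (S := P), hσ]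
  rfl

/-- If `σ` fixes the prime induced by `j`, then it preserves the corresponding valuation ring. -/
theorem norm_map_le_one_of_smul_padicPrime_eq {j : L →+* PadicAlgCl p} {σ : Gal(L/ℚ)}
    (h : σ • padicPrime j = padicPrime j) {z : L} (hz : ‖j z‖ ≤ 1) : ‖j (σ z)‖ ≤ 1 := by
  have hσ (a : 𝓞 L) : ‖j (σ a)‖ < 1 ↔ ‖j a‖ < 1 := by
    have := Ideal.smul_mem_pointwise_smul_iff (a := σ) (S := padicPrime j) (x := a)
    rw [h] at this
    exact this
  have hone {a : 𝓞 L} (ha : a ∉ padicPrime j) : ‖j a‖ = 1 ∧ ‖j (σ a)‖ = 1 :=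
    ⟨(norm_map_ringOfIntegers_le_one j a).antisymm (not_lt.1 ha),
      (norm_map_ringOfIntegers_le_one j (σ • a)).antisymm (not_lt.1 (mt (hσ a).1 ha))⟩
  have hbot : padicPrime j ≠ ⊥ := fun h0 ↦ by
    have := natCast_mem_padicPrime j
    rw [h0, Ideal.mem_bot, Nat.cast_eq_zero] at this
    exact (Fact.out : p.Prime).ne_zero this
  obtain ⟨n, d, hnd | hnd⟩ := HeightOneSpectrum.exists_primeCompl_mul_eq_or_mul_eq
    (⟨padicPrime j, inferInstance, hbot⟩ : HeightOneSpectrum (𝓞 L)) z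
  · have := congrArg (fun w ↦ ‖j (σ w)‖) hnd
    simp only [map_mul, norm_mul] at this
    rw [(hone d.2).2, mul_one] at this
    exact this.trans_le (norm_map_ringOfIntegers_le_one j (σ • n))
  · have h1 := congrArg (fun w ↦ ‖j w‖) hnd
    have h2 := congrArg (fun w ↦ ‖j (σ w)‖) hnd
    simp only [map_mul, norm_mul] at h1 h2
    rw [(hone d.2).1] at h1
    rw [(hone d.2).2] at h2
    have hn : n ∉ padicPrime j := fun hn ↦ by
      have := mem_padicPrime.1 hn
      nlinarith [norm_nonneg (j (algebraMap (𝓞 L) L n))]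
    rw [(hone hn).2, mul_one] at h2
    exact h2.le

theorem apply_eq_self_of_smul_padicPrime_eq {j : L →+* PadicAlgCl p} {σ : Gal(L/ℚ)}
    (h : σ • padicPrime j = padicPrime j) {x : L} {y : ℚ_[p]}
    (hxy : j x = algebraMap ℚ_[p] (PadicAlgCl p) y) : σ x = x := by
  have hp0 : 0 < ‖(p : PadicAlgCl p)‖ := by
    rw [norm_pos_iff]
    exact_mod_cast (Fact.out : p.Prime).ne_zero
  have key (k : ℕ) : ‖j (σ x) - j x‖ ≤ ‖(p : PadicAlgCl p)‖ ^ k := by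
    obtain ⟨r, hr⟩ := Padic.rat_dense p y (pow_pos hp0 k)
    have h1 : ‖j x - r‖ < ‖(p : PadicAlgCl p)‖ ^ k := by
      rw [← PadicAlgCl.norm_extends] at hr
      simpa [hxy] using hr
    have h2 : ‖j (σ x) - r‖ ≤ ‖(p : PadicAlgCl p)‖ ^ k := by
      have := norm_map_le_one_of_smul_padicPrime_eq h (z := (x - r) / p ^ k)
        (by simpa [div_le_one (pow_pos hp0 k)] using h1.le)
      simpa [div_le_one (pow_pos hp0 k)] using this
    have := PadicAlgCl.isNonarchimedean p (j (σ x) - r) (-(j x - r))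
    rw [norm_neg, ← sub_eq_add_neg, sub_sub_sub_cancel_right] at this
    exact this.trans (max_le h2 h1.le)
  have := ge_of_tendsto' (tendsto_pow_atTop_nhds_zero_of_lt_one hp0.le norm_natCast_prime_lt_one)
    key
  exact j.injective (sub_eq_zero.1 (norm_le_zero_iff.1 this))

/-- An element of the decomposition group of the prime induced by `j` extends to `ℚ̄_p`. -/
theorem exists_algEquiv_of_smul_padicPrime_eq [IsGalois ℚ L] {j : L →+* PadicAlgCl p}
    {σ : Gal(L/ℚ)} (h : σ • padicPrime j = padicPrime j) :
    ∃ g : PadicAlgCl p ≃ₐ[ℚ_[p]] PadicAlgCl p, ∀ x, j (σ x) = g (j x) := by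
  let := j.toAlgebra
  have : IsScalarTower ℚ L (PadicAlgCl p) := .of_algebraMap_eq' (RingHom.ext_rat _ _)
  let f : Gal(PadicAlgCl p/ℚ_[p]) →* Gal(L/ℚ) :=
    (AlgEquiv.restrictNormalHom L).comp (AlgEquiv.restrictScalarsHom ℚ)
  have hf (g : Gal(PadicAlgCl p/ℚ_[p])) (x : L) : j (f g x) = g (j x) :=
    AlgEquiv.restrictNormal_commutes (g.restrictScalars ℚ) L x
  suffices σ ∈ f.range by
    obtain ⟨g, rfl⟩ := this
    exact ⟨g, hf g⟩
  rw [← IntermediateField.fixingSubgroup_fixedField f.range, IntermediateField.mem_fixingSubgroup_iff]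
  intro x hx
  have hfix : j x ∈ (⊥ : IntermediateField ℚ_[p] (PadicAlgCl p)) := by
    rw [InfiniteGalois.mem_bot_iff_fixed]
    intro g
    rw [← hf, show f g x = x from hx ⟨f g, g, rfl⟩]
  obtain ⟨y, hy⟩ := IntermediateField.mem_bot.1 hfix
  exact apply_eq_self_of_smul_padicPrime_eq h hy.symm

/-- Two embeddings of a field into a Galois number field differ by an automorphism. -/
theorem exists_algEquiv_apply_eq [IsGalois ℚ L] {F : Type*} [Field F] [CharZero F]
    (τ σ : F →+* L) : ∃ s : Gal(L/ℚ), ∀ x, s (τ x) = σ x := by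
  let τ' := τ.toRatAlgHom
  let σ' := σ.toRatAlgHom
  let e : τ'.fieldRange ≃ₐ[ℚ] σ'.fieldRange :=
    (AlgEquiv.ofInjectiveField τ').symm.trans (AlgEquiv.ofInjectiveField σ')
  have he (x : F) : e (AlgEquiv.ofInjectiveField τ' x) = AlgEquiv.ofInjectiveField σ' x :=
    congrArg (AlgEquiv.ofInjectiveField σ') (AlgEquiv.symm_apply_apply _ x)
  refine ⟨e.liftNormal L, fun x ↦ ?_⟩
  exact (e.liftNormal_commutes L (AlgEquiv.ofInjectiveField τ' x)).trans
    (congrArg (algebraMap σ'.fieldRange L) (he x))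

end

end NumberField

end

theorem exists_prime_and_padic_embedding_conjugating
    (Qbar : Type*) [Field Qbar] [Algebra ℚ Qbar] [IsAlgClosure ℚ Qbar]
    (F : Type*) [Field F] [NumberField F]
    (S : Finset ℕ) (τ σ : F →+* Qbar) :
    ∃ (p : ℕ) (hp : p.Prime), p ∉ S ∧
      letI : Fact p.Prime := ⟨hp⟩
      ∃ (j : Qbar →+* AlgebraicClosure ℚ_[p])
        (g : AlgebraicClosure ℚ_[p] ≃ₐ[ℚ_[p]] AlgebraicClosure ℚ_[p]),
        ∀ x : F, j (σ x) = g (j (τ x)) := by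
  have : IsAlgClosed Qbar := IsAlgClosure.isAlgClosed ℚ
  have : Algebra.IsAlgebraic ℚ Qbar := IsAlgClosure.isAlgebraic
  have : Normal ℚ Qbar := IsAlgClosure.normal ℚ Qbar
  have : CharZero Qbar := algebraRat.charZero Qbar
  let L := IntermediateField.normalClosure ℚ F Qbar
  have hL : L.algebra' = DivisionRing.toRatAlgebra := Subsingleton.elim _ _
  have hfin : FiniteDimensional ℚ L := normalClosure.is_finiteDimensional ℚ F Qbar
  have hnormal : Normal ℚ L := by
    rw [← hL]
    exact normalClosure.normal ℚ F Qbar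
  have : NumberField L := { to_finiteDimensional := by rwa [← hL] }
  have : IsGalois ℚ L := ⟨⟩
  have hτ (x : F) : τ x ∈ L := τ.toRatAlgHom.fieldRange_le_normalClosure ⟨x, rfl⟩
  have hσ (x : F) : σ x ∈ L := σ.toRatAlgHom.fieldRange_le_normalClosure ⟨x, rfl⟩
  obtain ⟨s, hs⟩ := NumberField.exists_algEquiv_apply_eq (τ.codRestrict L hτ) (σ.codRestrict L hσ)
  obtain ⟨p, P, hp, hpS, hpP, hsP⟩ := NumberField.exists_prime_smul_eq L s S
  have : Fact p.Prime := ⟨hp⟩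
  have := P.isPrime
  obtain ⟨j₀, hj₀⟩ := NumberField.exists_padicPrime_eq P.asIdeal hpP
  rw [← hj₀] at hsP
  obtain ⟨g, hg⟩ := NumberField.exists_algEquiv_of_smul_padicPrime_eq hsP
  let := j₀.toAlgebra
  have : Algebra.IsAlgebraic L Qbar := .tower_top (K := ℚ) L
  let j : Qbar →ₐ[L] PadicAlgCl p := IsAlgClosed.lift
  have hj (y : L) : j (y : Qbar) = j₀ y := j.commutes y
  refine ⟨p, hp, hpS, j, g, fun x ↦ ?_⟩
  have := hg (τ.codRestrict L hτ x)
  rw [hs, ← hj, ← hj] at this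
  exact this
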